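/- arXiv:0903.2965 — 2 statements merged into one kernel-verified Lean document; each statement's English description precedes it below -/
import Mathlib

section
/- Let A be a full affine submonoid of ℕ₀^k. Then the submonoid M = A + {∞·a : a ∈ A} of (ℕ₀*)^k is defined by a system of equations: there exist matrices D ∈ M_{n×k}(ℕ₀), E₁, E₂ ∈ M_{ℓ×k}(ℕ₀) and integers m_1,…,m_n ≥ 2 such that M is exactly the set of x ∈ (ℕ₀*)^k satisfying D·x ∈ (m₁ℕ₀*, …, m_nℕ₀*)ᵗ and E₁·x = E₂·x. -/
/-- A submonoid `A` of `ℕ₀^k` is full if `x ∈ A`, `t ∈ ℕ₀^k`, `x + t ∈ A` imply `t ∈ A`. -/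
def IsFullAddSubmonoid {k : ℕ} (A : AddSubmonoid (Fin k → ℕ)) : Prop :=
  ∀ x ∈ A, ∀ t : Fin k → ℕ, x + t ∈ A → t ∈ A

/-- `∞·a ∈ (ℕ₀*)^k` for `a ∈ ℕ₀^k`: `i`-th entry `∞` when `a_i ≠ 0`, and `0` otherwise. -/
def infMul {k : ℕ} (a : Fin k → ℕ) : Fin k → ℕ∞ :=
  fun i => if a i = 0 then 0 else ⊤

open Finset in
theorem aux_stiemke {ι : Type*} [DecidableEq ι] (s : Finset ι) : ∀ V : AddSubgroup (ι → ℤ),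
    (∃ v ∈ V, ∀ i ∈ s, 0 < v i) ∨
    ∃ f : ι → ℤ, (∀ i ∈ s, 0 ≤ f i) ∧ (∃ i ∈ s, 0 < f i) ∧
      ∀ v ∈ V, ∑ i ∈ s, f i * v i = 0 := by
  induction s using Finset.induction_on with
  | empty => intro V; left; exact ⟨0, V.zero_mem, by simp⟩
  | insert n s hn ih =>
    intro V
    -- big multiple lemma
    have big : ∀ u ∈ V, ∀ w ∈ V, (∀ i ∈ s, 0 < u i) → u n = 0 → 0 < w n →
        ∃ v ∈ V, ∀ i ∈ insert n s, 0 < v i := by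
      intro u hu w hw hpos hun hwn
      refine ⟨(1 + ∑ i ∈ s, |w i|) • u + w, V.add_mem (V.zsmul_mem hu _) hw, ?_⟩
      intro i hi
      rcases Finset.mem_insert.1 hi with rfl | hi
      · simp [hun, hwn]
      · have h1 : |w i| ≤ ∑ i ∈ s, |w i| :=
          Finset.single_le_sum (f := fun i => |w i|) (fun j _ => abs_nonneg _) hi
        have h2 := neg_abs_le (w i)
        have h3 := hpos i hi
        have h4 := abs_nonneg (w i)
        simp only [Pi.add_apply, Pi.smul_apply, smul_eq_mul]
        nlinarith
    rcases ih V with ⟨v, hv, hvpos⟩ | ⟨f, hf0, ⟨i, hi, hfi⟩, hf⟩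
    swap
    · right
      refine ⟨fun j => if j = n then 0 else f j, ?_, ⟨i, by simp [hi], ?_⟩, ?_⟩
      · intro j hj
        rcases Finset.mem_insert.1 hj with rfl | hj
        · simp
        · by_cases h : j = n <;> simp [h, hf0 j hj]
          
      · have : i ≠ n := by rintro rfl; exact hn hi
        simp [this, hfi]
      · intro v hv
        refine Eq.trans ?_ (hf v hv)
        rw [Finset.sum_insert hn]
        dsimp only
        rw [if_pos rfl, zero_mul, zero_add]
        refine Finset.sum_congr rfl fun j hj => ?_
        have : j ≠ n := by rintro rfl; exact hn hj
        simp [this]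
    rcases lt_trichotomy (v n) 0 with hvn | hvn | hvn
    · let V0 : AddSubgroup (ι → ℤ) := V ⊓ (Pi.evalAddMonoidHom (fun _ : ι => ℤ) n).ker
      rcases ih V0 with ⟨u, hu, hupos⟩ | ⟨f, hf0, ⟨i, hi, hfi⟩, hf⟩
      · left
        obtain ⟨huV, hun⟩ := hu
        exact big u huV (-v) (V.neg_mem hv) hupos (by simpa using hun) (by simpa using hvn)
      · right
        have hfv : 0 < ∑ i ∈ s, f i * v i :=
          Finset.sum_pos' (fun j hj => mul_nonneg (hf0 j hj) (hvpos j hj).le)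
            ⟨i, hi, mul_pos hfi (hvpos i hi)⟩
        refine ⟨fun j => if j = n then ∑ i ∈ s, f i * v i else (- v n) * f j, ?_,
          ⟨n, by simp, by simpa using hfv⟩, ?_⟩
        · intro j hj
          by_cases h : j = n
          · simp [h, hfv.le]
          · have hj' : j ∈ s := by simpa [h] using hj
            have := hf0 j hj'
            simp only [h, if_false]
            nlinarith
        · intro w hw
          have h0 := hf (v n • w - w n • v) ⟨V.sub_mem (V.zsmul_mem hw _) (V.zsmul_mem hv _), by
            simp [AddMonoidHom.mem_ker, mul_comm]⟩
          rw [Finset.sum_insert hn]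
          have h1 : ∑ x ∈ s, (if x = n then ∑ i ∈ s, f i * v i else (- v n) * f x) * w x
              = ∑ x ∈ s, (- v n) * f x * w x := by
            refine Finset.sum_congr rfl fun j hj => ?_
            have : j ≠ n := by rintro rfl; exact hn hj
            simp [this]
          dsimp only
          rw [h1, if_pos rfl, Finset.sum_mul, ← Finset.sum_add_distrib, ← neg_eq_zero, ← h0,
            ← Finset.sum_neg_distrib]
          refine Finset.sum_congr rfl fun j hj => ?_
          simp only [Pi.sub_apply, Pi.smul_apply, smul_eq_mul]
          ring
    · by_cases h : ∃ w ∈ V, w n ≠ 0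
      · left
        obtain ⟨w, hw, hwn⟩ := h
        rcases lt_or_gt_of_ne hwn with h | h
        · exact big v hv (-w) (V.neg_mem hw) hvpos hvn (by simpa using h)
        · exact big v hv w hw hvpos hvn h
      · right
        push Not at h
        refine ⟨fun j => if j = n then 1 else 0, ?_, ⟨n, by simp, by simp⟩, ?_⟩
        · intro j _
          dsimp only
          split_ifs <;> simp
        · intro w hw
          simp [h w hw]
    · left
      refine ⟨v, hv, fun i hi => ?_⟩
      rcases Finset.mem_insert.1 hi with rfl | hi
      · exact hvn
      · exact hvpos i hi

theorem aux_span {ι : Type*} [DecidableEq ι] (J : Finset ι) (f : (ι → ℤ) →+ ℤ) :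
    ∀ V : AddSubgroup (ι → ℤ),
    (∀ v ∈ V, (∀ j ∈ J, v j = 0) → f v = 0) →
    ∃ N : ℤ, 0 < N ∧ ∃ c : ι → ℤ, ∀ v ∈ V, N * f v = ∑ j ∈ J, c j * v j := by
  induction J using Finset.induction_on with
  | empty =>
    intro V h
    exact ⟨1, one_pos, 0, fun v hv => by simp [h v hv]⟩
  | insert n s hn ih =>
    intro V h
    let V0 : AddSubgroup (ι → ℤ) := V ⊓ (Pi.evalAddMonoidHom (fun _ : ι => ℤ) n).ker
    obtain ⟨N, hN, c, hc⟩ := ih V0 (by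
      rintro v ⟨hv, hvn⟩ hs
      refine h v hv fun j hj => ?_
      rcases Finset.mem_insert.1 hj with rfl | hj
      · simpa using hvn
      · exact hs j hj)
    have key : ∀ (a b : ℤ) (w : ι → ℤ),
        ∑ x ∈ s, (if x = n then a else b * c x) * w x = b * ∑ x ∈ s, c x * w x := by
      intro a b w
      rw [Finset.mul_sum]
      refine Finset.sum_congr rfl fun j hj => ?_
      have : j ≠ n := by rintro rfl; exact hn hj
      simp [this, mul_assoc]
    by_cases hex : ∃ v ∈ V, 0 < v n
    · obtain ⟨v, hv, hvn⟩ := hex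
      refine ⟨v n * N, mul_pos hvn hN,
        fun j => if j = n then N * f v - ∑ j ∈ s, c j * v j else v n * c j, fun w hw => ?_⟩
      have h0 := hc (v n • w - w n • v) ⟨V.sub_mem (V.zsmul_mem hw _) (V.zsmul_mem hv _), by
            simp [AddMonoidHom.mem_ker, mul_comm]⟩
      rw [Finset.sum_insert hn]
      dsimp only
      rw [key, if_pos rfl]
      have h1 : ∑ j ∈ s, c j * (v n • w - w n • v) j
          = v n * ∑ j ∈ s, c j * w j - w n * ∑ j ∈ s, c j * v j := by
        rw [Finset.mul_sum, Finset.mul_sum, ← Finset.sum_sub_distrib]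
        refine Finset.sum_congr rfl fun j hj => ?_
        simp only [Pi.sub_apply, Pi.smul_apply, smul_eq_mul]
        ring
      rw [h1, map_sub, map_zsmul, map_zsmul] at h0
      simp only [smul_eq_mul] at h0
      linarith
    · push Not at hex
      have hz : ∀ v ∈ V, v n = 0 := by
        intro v hv
        have h1 := hex v hv
        have h2 := hex (-v) (V.neg_mem hv)
        simp at h2
        omega
      refine ⟨N, hN, c, fun v hv => ?_⟩
      rw [Finset.sum_insert hn, hz v hv, hc v ⟨hv, by simp [hz v hv]⟩]
      simp

theorem aux_dual {k : ℕ} (H : AddSubgroup (Fin k → ℤ)) :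
    ∃ (r : ℕ) (d : Fin r → Fin k → ℤ) (m : Fin r → ℕ),
      ∀ y, y ∈ H ↔ ∀ j, (m j : ℤ) ∣ ∑ i, d j i * y i := by
  classical
  have : Module.Finite ℤ ((Fin k → ℤ) ⧸ H) :=
    Module.Finite.of_surjective (QuotientAddGroup.mk' H).toIntLinearMap
      (QuotientAddGroup.mk'_surjective H)
  have : AddGroup.FG ((Fin k → ℤ) ⧸ H) := by
    rw [← Module.Finite.iff_addGroup_fg]; exact this
  obtain ⟨n, ι, _, p, hp, e, ⟨φ⟩⟩ :=
    AddCommGroup.equiv_free_prod_directSum_zmod ((Fin k → ℤ) ⧸ H)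
  let q : (Fin k → ℤ) →+ (Fin n →₀ ℤ) × DirectSum ι (fun i => ZMod (p i ^ e i)) :=
    φ.toAddMonoidHom.comp (QuotientAddGroup.mk' H)
  have hq : ∀ y, y ∈ H ↔ q y = 0 := by
    intro y
    simp [q]
  have hsum : ∀ y : Fin k → ℤ, y = ∑ i, y i • (Pi.single i 1 : Fin k → ℤ) := by
    intro y
    ext j
    simp [Finset.sum_apply, Pi.single_apply]
  let F : Fin n ⊕ ι → Fin k → ℤ := fun t i => match t with
    | .inl a => (q (Pi.single i 1)).1 a
    | .inr b => ((q (Pi.single i 1)).2 b).cast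
  let m : Fin n ⊕ ι → ℕ := fun t => match t with
    | .inl a => 0
    | .inr b => p b ^ e b
  have h1 : ∀ y a, (q y).1 a = ∑ i, F (.inl a) i * y i := by
    intro y a
    conv_lhs => rw [hsum y, map_sum, Prod.fst_sum, Finsupp.finsetSum_apply]
    refine Finset.sum_congr rfl fun i _ => ?_
    rw [map_zsmul, Prod.smul_fst, Finsupp.smul_apply, smul_eq_mul, mul_comm]
  have h2 : ∀ y b, (q y).2 b = ((∑ i, F (.inr b) i * y i : ℤ) : ZMod (p b ^ e b)) := by
    intro y b
    conv_lhs => rw [hsum y, map_sum, Prod.snd_sum, DirectSum.sum_apply]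
    rw [Int.cast_sum]
    refine Finset.sum_congr rfl fun i _ => ?_
    simp only [map_zsmul, F, Prod.smul_snd, Int.cast_mul, ZMod.intCast_zmod_cast]
    rw [mul_comm, ← zsmul_eq_mul]
    rfl
  have h3 : ∀ y, y ∈ H ↔ ∀ t, (m t : ℤ) ∣ ∑ i, F t i * y i := by
    intro y
    rw [hq, Prod.ext_iff, Finsupp.ext_iff, DFinsupp.ext_iff, Sum.forall]
    refine and_congr (forall_congr' fun a => ?_) (forall_congr' fun b => ?_)
    · rw [h1]; simp [m]
    · have := h2 y b
      rw [← ZMod.intCast_zmod_eq_zero_iff_dvd] 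
      rw [← this]; rfl
  let E := Fintype.equivFin (Fin n ⊕ ι)
  refine ⟨_, fun j => F (E.symm j), fun j => m (E.symm j), fun y => ?_⟩
  rw [h3]
  exact (E.symm.forall_congr_right (q := fun t => (m t : ℤ) ∣ ∑ i, F t i * y i)).symm

theorem aux_sum_infMul {k : ℕ} (D a b : Fin k → ℕ) :
    ∑ i, (D i : ℕ∞) * ((fun i => (a i : ℕ∞)) + infMul b) i =
      if ∑ i, D i * b i = 0 then ((∑ i, D i * a i : ℕ) : ℕ∞) else ⊤ := by
  split_ifs with h
  · rw [Finset.sum_eq_zero_iff] at h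
    push_cast
    refine Finset.sum_congr rfl fun i hi => ?_
    rcases Nat.mul_eq_zero.1 (h i hi) with h | h <;> simp [h, infMul]
  · have : ∃ i, D i * b i ≠ 0 := by
      by_contra hc
      push Not at hc
      exact h (Finset.sum_eq_zero fun i _ => hc i)
    obtain ⟨i, hi⟩ := this
    rw [Nat.mul_ne_zero_iff] at hi
    refine WithTop.sum_eq_top.2 ⟨i, Finset.mem_univ _, ?_⟩
    have : (D i : ℕ∞) ≠ 0 := by exact_mod_cast hi.1
    simp only [Pi.add_apply, infMul, hi.2, if_false, add_top]
    exact ENat.mul_top this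

theorem aux_sum_fin {k : ℕ} (D : Fin k → ℕ) (x : Fin k → ℕ∞) (h : ∀ i, x i = ⊤ → D i = 0) :
    ∑ i, (D i : ℕ∞) * x i = ((∑ i, D i * (x i).toNat : ℕ) : ℕ∞) := by
  push_cast
  refine Finset.sum_congr rfl fun i _ => ?_
  by_cases hx : x i = ⊤
  · simp [h i hx]
  · rw [ENat.natCast_toNat hx]

/-- the group generated by `A`. -/
def auxGroup {k : ℕ} (A : AddSubmonoid (Fin k → ℕ)) : AddSubgroup (Fin k → ℤ) where
  carrier := {g | ∃ a ∈ A, ∃ b ∈ A, ∀ i, g i = (a i : ℤ) - b i}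
  zero_mem' := ⟨0, A.zero_mem, 0, A.zero_mem, by simp⟩
  add_mem' := by
    rintro g g' ⟨a, ha, b, hb, h⟩ ⟨a', ha', b', hb', h'⟩
    refine ⟨a + a', A.add_mem ha ha', b + b', A.add_mem hb hb', fun i => ?_⟩
    simp [h, h']; ring
  neg_mem' := by
    rintro g ⟨a, ha, b, hb, h⟩
    exact ⟨b, hb, a, ha, fun i => by simp [h]⟩

theorem aux_coe_mem {k : ℕ} (A : AddSubmonoid (Fin k → ℕ)) {a : Fin k → ℕ} (ha : a ∈ A) :
    (fun i => (a i : ℤ)) ∈ auxGroup A := ⟨a, ha, 0, A.zero_mem, by simp⟩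

theorem aux_mem_of {k : ℕ} {A : AddSubmonoid (Fin k → ℕ)} (hA : IsFullAddSubmonoid A)
    {g : Fin k → ℤ} (hg : g ∈ auxGroup A) (t : Fin k → ℕ) (ht : ∀ i, (t i : ℤ) = g i) :
    t ∈ A := by
  obtain ⟨a, ha, b, hb, h⟩ := hg
  refine hA b hb t ?_
  convert ha using 1
  ext i
  have h1 := h i
  have h2 := ht i
  simp only [Pi.add_apply]
  omega

theorem aux_eq_toNat {k : ℕ} (d : Fin k → ℤ) (a : Fin k → ℕ) :
    ∑ i, (d i).toNat * a i = ∑ i, (-d i).toNat * a i ↔ ∑ i, d i * (a i : ℤ) = 0 := by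
  have : ∑ i, d i * (a i : ℤ) = ((∑ i, (d i).toNat * a i : ℕ) : ℤ)
      - ((∑ i, (-d i).toNat * a i : ℕ) : ℤ) := by
    push_cast
    rw [← Finset.sum_sub_distrib]
    refine Finset.sum_congr rfl fun i _ => ?_
    rw [← sub_mul]
    congr 1
    omega
  omega

theorem aux_mod {k : ℕ} (d : Fin k → ℤ) (m : ℕ) (hm : m ≠ 0) (a : Fin k → ℕ) :
    2 * m ∣ ∑ i, ((2 * d i) % (2 * m : ℕ)).toNat * a i ↔ (m : ℤ) ∣ ∑ i, d i * (a i : ℤ) := by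
  have hm' : ((2 * m : ℕ) : ℤ) ≠ 0 := by exact_mod_cast (by omega)
  rw [← Int.natCast_dvd_natCast]
  have h1 : (m : ℤ) ∣ ∑ i, d i * (a i : ℤ) ↔ ((2 * m : ℕ) : ℤ) ∣ ∑ i, (2 * d i) * (a i : ℤ) := by
    simp only [mul_assoc]
    rw [← Finset.mul_sum]
    push_cast
    exact (mul_dvd_mul_iff_left two_ne_zero).symm
  rw [h1]
  refine (Int.ModEq.dvd_iff ?_)
  push_cast
  refine Int.ModEq.sum fun i _ => ?_
  rw [Int.toNat_of_nonneg (by have := Int.emod_nonneg (2 * d i) hm'; push_cast at this; exact this)]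
  exact (Int.mod_modEq _ _).mul_right _

theorem aux_pattern {k : ℕ} (A : AddSubmonoid (Fin k → ℕ)) (hA : IsFullAddSubmonoid A)
    (I : Finset (Fin k)) :
    ∃ (n l : ℕ) (D : Fin n → Fin k → ℕ) (E₁ E₂ : Fin l → Fin k → ℕ) (m : Fin n → ℕ),
      (∀ j, 2 ≤ m j) ∧
      (∀ a ∈ A, (∀ j, m j ∣ ∑ i, D j i * a i) ∧ ∀ j, ∑ i, E₁ j i * a i = ∑ i, E₂ j i * a i) ∧
      ∀ x : Fin k → ℕ∞, (∀ i, x i = ⊤ ↔ i ∈ I) →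
          ((∀ j, ∃ t : ℕ∞, ∑ i, (D j i : ℕ∞) * x i = (m j : ℕ∞) * t) ∧
           (∀ j, ∑ i, (E₁ j i : ℕ∞) * x i = ∑ i, (E₂ j i : ℕ∞) * x i)) →
        (∃ a ∈ A, ∃ b ∈ A, x = (fun i => (a i : ℕ∞)) + infMul b) := by
  classical
  by_cases hI : ∃ b ∈ A, ∀ i, b i ≠ 0 ↔ i ∈ I
  · obtain ⟨b0, hb0, hbI⟩ := hI
    let Z : AddSubgroup (Fin k → ℤ) :=
      { carrier := {z | ∀ i, i ∉ I → z i = 0}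
        zero_mem' := by simp
        add_mem' := by
          intro a b ha hb i hi
          simp [ha i hi, hb i hi]
        neg_mem' := by
          intro a ha i hi
          simp [ha i hi] }
    obtain ⟨r, d, m, hd⟩ := aux_dual (auxGroup A ⊔ Z)
    have hdI : ∀ j, ∀ i ∈ I, (m j : ℤ) ∣ d j i := by
      intro j i hi
      have := (hd (Pi.single i 1)).1 (AddSubgroup.mem_sup_right (by
        intro i' hi'
        have : i' ≠ i := by rintro rfl; exact hi' hi
        simp [this])) j
      simpa [Pi.single_apply] using this
    refine ⟨r, r, fun j i => if m j = 0 then 0 else ((2 * d j i) % (2 * m j : ℕ)).toNat,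
      fun j i => if m j = 0 then (d j i).toNat else 0,
      fun j i => if m j = 0 then (- d j i).toNat else 0,
      fun j => if m j = 0 then 2 else 2 * m j, ?_, ?_, ?_⟩
    · intro j
      dsimp only
      split_ifs <;> omega
    · intro a ha
      have h := (hd (fun i => (a i : ℤ))).1 (AddSubgroup.mem_sup_left (aux_coe_mem A ha))
      refine ⟨fun j => ?_, fun j => ?_⟩
      · by_cases hm : m j = 0
        · simp [hm]
        · simp only [hm, if_false]
          exact (aux_mod (d j) (m j) hm a).2 (h j)
      · by_cases hm : m j = 0
        · simp only [hm, if_true]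
          have := h j
          rw [hm] at this
          exact (aux_eq_toNat (d j) a).2 (by simpa using this)
        · simp [hm]
    · rintro x hx ⟨h1, h2⟩
      have hy : (fun i => ((x i).toNat : ℤ)) ∈ auxGroup A ⊔ Z := by
        rw [hd]
        intro j
        by_cases hm : m j = 0
        · have h := h2 j
          simp only [hm, if_true] at h
          have hz : ∀ i, x i = ⊤ → d j i = 0 := by
            intro i hi
            have := hdI j i ((hx i).1 hi)
            simpa [hm] using this
          rw [aux_sum_fin _ x (fun i hi => by simp [hz i hi]),
            aux_sum_fin _ x (fun i hi => by simp [hz i hi])] at h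
          rw [hm]
          simpa using (aux_eq_toNat (d j) (fun i => (x i).toNat)).1 (by exact_mod_cast h)
        · obtain ⟨t, h⟩ := h1 j
          simp only [hm, if_false] at h
          rw [aux_sum_fin _ x] at h
          · apply (aux_mod (d j) (m j) hm _).1
            have ht : t ≠ ⊤ := by
              rintro rfl
              rw [ENat.mul_top (by exact_mod_cast (by omega))] at h
              exact ENat.natCast_ne_top _ h
            lift t to ℕ using ht
            exact ⟨t, by exact_mod_cast h⟩
          · intro i hi
            have h3 := hdI j i ((hx i).1 hi)
            have : (2 * d j i) % (2 * m j : ℕ) = 0 := by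
              apply Int.emod_eq_zero_of_dvd
              push_cast
              exact mul_dvd_mul_left _ h3
            rw [this]; rfl
      obtain ⟨g, hg, z, hz, hgz⟩ := AddSubgroup.mem_sup.1 hy
      obtain ⟨a, ha, b, hb, hab⟩ := id hg
      have hgz' : ∀ i, g i + z i = ((x i).toNat : ℤ) := fun i => congrFun hgz i
      have hg2 : g + (∑ i, b i) • (fun i => (b0 i : ℤ)) ∈ auxGroup A :=
        (auxGroup A).add_mem hg ((auxGroup A).nsmul_mem (aux_coe_mem A hb0) _)
      have hnn : ∀ i, 0 ≤ (g + (∑ i, b i) • (fun i => (b0 i : ℤ))) i := by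
        intro i
        rw [Pi.add_apply, Pi.smul_apply, nsmul_eq_mul]
        by_cases hi : i ∈ I
        · have e1 := (hbI i).2 hi
          have e2 : b i ≤ ∑ i, b i := Finset.single_le_sum (fun _ _ => Nat.zero_le _)
            (Finset.mem_univ i)
          have e3 : (∑ i, b i) * 1 ≤ (∑ i, b i) * b0 i :=
            Nat.mul_le_mul_left _ (Nat.one_le_iff_ne_zero.2 e1)
          rw [hab i]
          have e4 : b i ≤ (∑ i, b i) * b0 i := by omega
          have e5 : (b i : ℤ) ≤ ((∑ i, b i : ℕ) : ℤ) * b0 i := by exact_mod_cast e4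
          omega
        · have := hgz' i
          rw [hz i hi] at this
          have : 0 ≤ g i := by omega
          positivity
      refine ⟨fun i => ((g + (∑ i, b i) • (fun i => (b0 i : ℤ))) i).toNat,
        aux_mem_of hA hg2 _ (fun i => Int.toNat_of_nonneg (hnn i)), b0, hb0, ?_⟩
      ext1 i
      by_cases hi : i ∈ I
      · have e1 := (hbI i).2 hi
        simp [infMul, e1, (hx i).2 hi]
      · have e1 : b0 i = 0 := by
          by_contra h
          exact hi ((hbI i).1 h)
        have e2 : x i ≠ ⊤ := fun h => hi ((hx i).1 h)
        have e3 := hgz' i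
        rw [hz i hi, add_zero] at e3
        simp [infMul, e1, e3, ENat.natCast_toNat e2]
  · -- no element of `A` with support `I`
    let V0 : AddSubgroup (Fin k → ℤ) :=
      { carrier := {g | g ∈ auxGroup A ∧ ∀ j ∈ Iᶜ, g j = 0}
        zero_mem' := ⟨(auxGroup A).zero_mem, by simp⟩
        add_mem' := by
          rintro a b ⟨ha, ha'⟩ ⟨hb, hb'⟩
          exact ⟨(auxGroup A).add_mem ha hb, fun j hj => by simp [ha' j hj, hb' j hj]⟩
        neg_mem' := by
          rintro a ⟨ha, ha'⟩
          exact ⟨(auxGroup A).neg_mem ha, fun j hj => by simp [ha' j hj]⟩ }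
    rcases aux_stiemke I V0 with ⟨v, ⟨hv, hv0⟩, hpos⟩ | ⟨f, hf0, ⟨i0, hi0, hfi0⟩, hf⟩
    · exfalso
      have hnn : ∀ i, 0 ≤ v i := by
        intro i
        by_cases hi : i ∈ I
        · exact (hpos i hi).le
        · exact (hv0 i (by simpa using hi)).ge
      refine hI ⟨fun i => (v i).toNat,
        aux_mem_of hA hv _ (fun i => Int.toNat_of_nonneg (hnn i)), fun i => ?_⟩
      by_cases hi : i ∈ I
      · have := hpos i hi
        simp only [hi, iff_true]; omega
      · have := hv0 i (by simpa using hi)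
        simp [hi, this]
    · let F : (Fin k → ℤ) →+ ℤ :=
        { toFun := fun v => ∑ i ∈ I, f i * v i
          map_zero' := by simp
          map_add' := by
            intro a b
            simp [mul_add, Finset.sum_add_distrib] }
      obtain ⟨N, hN, c, hc⟩ := aux_span Iᶜ F (auxGroup A) (fun v hv h0 => hf v ⟨hv, h0⟩)
      let e : Fin k → ℤ := fun i => if i ∈ I then N * f i else - c i
      have he : ∀ v ∈ auxGroup A, ∑ i, e i * v i = 0 := by
        intro v hv
        rw [← Finset.sum_add_sum_compl I]
        have e1 : ∑ i ∈ I, e i * v i = N * F v := by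
          change _ = N * ∑ i ∈ I, f i * v i
          rw [Finset.mul_sum]
          refine Finset.sum_congr rfl fun i hi => ?_
          simp [e, hi, mul_assoc]
        have e2 : ∑ i ∈ Iᶜ, e i * v i = - ∑ j ∈ Iᶜ, c j * v j := by
          rw [← Finset.sum_neg_distrib]
          refine Finset.sum_congr rfl fun i hi => ?_
          have : i ∉ I := by simpa using hi
          simp [e, this]
        rw [e1, e2, hc v hv]; ring
      refine ⟨0, 1, Fin.elim0, fun _ i => (e i).toNat, fun _ i => (- e i).toNat, Fin.elim0,
        fun j => j.elim0, ?_, ?_⟩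
      · intro a ha
        exact ⟨fun j => j.elim0, fun _ => (aux_eq_toNat e a).2 (he _ (aux_coe_mem A ha))⟩
      · rintro x hx ⟨-, h2⟩
        exfalso
        have h := h2 0
        dsimp only at h
        rw [aux_sum_fin (fun i => (- e i).toNat) x] at h
        · refine ENat.natCast_ne_top _ (h.symm.trans (WithTop.sum_eq_top.2 ⟨i0, Finset.mem_univ _, ?_⟩))
          rw [(hx i0).2 hi0]
          refine ENat.mul_top ?_
          have : 0 < e i0 := by
            simp only [e, hi0, if_true]; positivity
          exact_mod_cast (by omega : (e i0).toNat ≠ 0)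
        · intro i hi
          have h3 := (hx i).1 hi
          have : 0 ≤ e i := by
            simp only [e, h3, if_true]
            exact mul_nonneg hN.le (hf0 i h3)
          omega

/-- For a full affine submonoid `A` of `ℕ₀^k`, the submonoid `M = A + {∞·a : a ∈ A}` of
`(ℕ₀*)^k` is defined by a system of congruences and linear equations. -/
theorem stmt9 {k : ℕ} (A : AddSubmonoid (Fin k → ℕ)) (hA : IsFullAddSubmonoid A) :
    ∃ (n l : ℕ) (D : Fin n → Fin k → ℕ) (E₁ E₂ : Fin l → Fin k → ℕ) (m : Fin n → ℕ),
      (∀ j, 2 ≤ m j) ∧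
      ∀ x : Fin k → ℕ∞,
        (∃ a ∈ A, ∃ b ∈ A, x = (fun i => (a i : ℕ∞)) + infMul b) ↔
          ((∀ j, ∃ t : ℕ∞, ∑ i, (D j i : ℕ∞) * x i = (m j : ℕ∞) * t) ∧
           (∀ j, ∑ i, (E₁ j i : ℕ∞) * x i = ∑ i, (E₂ j i : ℕ∞) * x i)) := by
  classical
  choose n l D E₁ E₂ m hm hval hsol using aux_pattern A hA
  let e := Fintype.equivFin (Σ I : Finset (Fin k), Fin (n I))
  let e' := Fintype.equivFin (Σ I : Finset (Fin k), Fin (l I))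
  refine ⟨_, _, fun j => D (e.symm j).1 (e.symm j).2, fun j => E₁ (e'.symm j).1 (e'.symm j).2,
    fun j => E₂ (e'.symm j).1 (e'.symm j).2, fun j => m (e.symm j).1 (e.symm j).2,
    fun j => hm _ _, fun x => ⟨?_, ?_⟩⟩
  · rintro ⟨a, ha, b, hb, rfl⟩
    refine ⟨fun j => ?_, fun j => ?_⟩
    · rw [aux_sum_infMul]
      split_ifs with h
      · obtain ⟨t, ht⟩ := (hval (e.symm j).1 a ha).1 (e.symm j).2
        exact ⟨t, by rw [ht]; push_cast; rfl⟩
      · refine ⟨⊤, (ENat.mul_top ?_).symm⟩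
        have := hm (e.symm j).1 (e.symm j).2
        have h3 : m (e.symm j).1 (e.symm j).2 ≠ 0 := by omega
        exact_mod_cast h3
    · dsimp only
      rw [aux_sum_infMul, aux_sum_infMul, (hval (e'.symm j).1 a ha).2 (e'.symm j).2,
        (hval (e'.symm j).1 b hb).2 (e'.symm j).2]
  · rintro ⟨h1, h2⟩
    refine hsol (Finset.univ.filter fun i => x i = ⊤) x (by simp) ⟨fun j => ?_, fun j => ?_⟩
    · have := h1 (e ⟨_, j⟩)
      dsimp only at this
      rwa [Equiv.symm_apply_apply] at this
    · have := h2 (e' ⟨_, j⟩)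
      dsimp only at this
      rwa [Equiv.symm_apply_apply] at this
end

section
/- Let R be a semilocal ring with R/J(R) ≅ D₁ × D₂ for division rings D₁, D₂, and fix an onto ring homomorphism φ : R → D₁ × D₂ with kernel J(R). If R has a nonfree finitely generated projective right module, then there exists n ∈ ℕ such that dim_φ V(R) is the submonoid of ℕ₀² generated by (1,1), (n,0) and (0,n); equivalently dim_φ V(R) = {(x,y) ∈ ℕ₀² : x + (n−1)y ≡ 0 mod n}. -/
/-- The submodule `J(R)·M` of a left `R`-module `M`, where `J(R)` is the Jacobson
radical. -/
def radSub (R : Type u) (M : Type v) [Ring R] [AddCommGroup M] [Module R M] :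
    Submodule R M :=
  Submodule.span R {x : M | ∃ a ∈ Ideal.jacobson (⊥ : Ideal R), ∃ m : M, x = a • m}

/-- `P` has dimension vector `(x,y)` with respect to `φ : R → D₁ × D₂`:
`P/PJ(R) ≅ D₁^x × D₂^y` as `R`-modules (the right-hand side an `R`-module via `φ`). -/
def HasDimVector {R D₁ D₂ : Type u} [Ring R] [DivisionRing D₁] [DivisionRing D₂]
    (φ : R →+* D₁ × D₂) (P : Type u) [AddCommGroup P] [Module R P] (x y : ℕ) : Prop :=
  letI : Module R (Fin x → D₁) :=
    Module.compHom (Fin x → D₁) ((RingHom.fst D₁ D₂).comp φ)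
  letI : Module R (Fin y → D₂) :=
    Module.compHom (Fin y → D₂) ((RingHom.snd D₁ D₂).comp φ)
  Nonempty ((P ⧸ radSub R P) ≃ₗ[R] ((Fin x → D₁) × (Fin y → D₂)))

section helpers

theorem radSub_smul_mem {R : Type u} {M : Type v} [Ring R] [AddCommGroup M] [Module R M]
    {a : R} (ha : a ∈ Ideal.jacobson (⊥ : Ideal R)) (m : M) : a • m ∈ radSub R M :=
  Submodule.subset_span ⟨a, ha, m, rfl⟩

theorem radSub_le_comap {R : Type u} {M : Type v} {N : Type w} [Ring R] [AddCommGroup M]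
    [Module R M] [AddCommGroup N] [Module R N] (f : M →ₗ[R] N) :
    radSub R M ≤ (radSub R N).comap f := by
  refine Submodule.span_le.2 ?_
  rintro _ ⟨a, ha, m, rfl⟩
  simp only [SetLike.mem_coe, Submodule.mem_comap, map_smul]
  exact radSub_smul_mem ha _

theorem radSub_le_smul {R : Type u} {M : Type v} [Ring R] [AddCommGroup M] [Module R M] :
    radSub R M ≤ Ring.jacobson R • (⊤ : Submodule R M) := by
  refine Submodule.span_le.2 ?_
  rintro _ ⟨a, ha, m, rfl⟩
  rw [Ideal.jacobson_bot] at ha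
  exact Submodule.smul_mem_smul ha trivial

theorem radSub_nak {R : Type u} {M : Type v} [Ring R] [AddCommGroup M] [Module R M]
    [Module.Finite R M] (h : radSub R M = ⊤) : Subsingleton M := by
  have := Submodule.FG.eq_bot_of_le_jacobson_smul (R := R) (N := (⊤ : Submodule R M))
    Module.Finite.fg_top (h.symm.le.trans radSub_le_smul)
  rw [← Submodule.subsingleton_iff R]
  exact subsingleton_of_bot_eq_top this.symm

theorem radSub_nak_sup {R : Type u} {M : Type v} [Ring R] [AddCommGroup M] [Module R M]
    [Module.Finite R M] (N : Submodule R M) (h : ∀ m : M, ∃ n ∈ N, n - m ∈ radSub R M) :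
    N = ⊤ := by
  have : Subsingleton (M ⧸ N) := by
    apply radSub_nak (R := R)
    rw [eq_top_iff]
    rintro x -
    obtain ⟨m, rfl⟩ := N.mkQ_surjective x
    obtain ⟨n, hn, hm⟩ := h m
    have h2 := radSub_le_comap N.mkQ hm
    have h3 : N.mkQ n = 0 := by simpa using hn
    rw [Submodule.mem_comap, map_sub, h3, zero_sub] at h2
    simpa using h2
  exact Submodule.Quotient.subsingleton_iff.1 this

variable {R D₁ D₂ : Type u} [Ring R] [DivisionRing D₁] [DivisionRing D₂]
  [Module R D₁] [Module R D₂]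

/-- Alternative description of dimension vectors. -/
def DV (R D₁ D₂ : Type u) [Ring R] [DivisionRing D₁] [DivisionRing D₂]
    [Module R D₁] [Module R D₂] (P : Type u) [AddCommGroup P] [Module R P] (x y : ℕ) : Prop :=
  ∃ g : P →ₗ[R] (Fin x → D₁) × (Fin y → D₂), Function.Surjective g ∧
    LinearMap.ker g = radSub R P

theorem DV_iff (P : Type u) [AddCommGroup P] [Module R P] (x y : ℕ) :
    DV R D₁ D₂ P x y ↔
      Nonempty ((P ⧸ radSub R P) ≃ₗ[R] ((Fin x → D₁) × (Fin y → D₂))) := by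
  constructor
  · rintro ⟨g, hg, hk⟩
    exact ⟨(Submodule.quotEquivOfEq _ _ hk.symm).trans (g.quotKerEquivOfSurjective hg)⟩
  · rintro ⟨e⟩
    refine ⟨e.toLinearMap ∘ₗ (radSub R P).mkQ, ?_, ?_⟩
    · exact e.surjective.comp (Submodule.mkQ_surjective _)
    · rw [LinearEquiv.ker_comp, Submodule.ker_mkQ]

theorem DV_equiv {P Q : Type u} [AddCommGroup P] [Module R P] [AddCommGroup Q] [Module R Q]
    (e : Q ≃ₗ[R] P) {x y : ℕ} (h : DV R D₁ D₂ P x y) : DV R D₁ D₂ Q x y := by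
  obtain ⟨g, hg, hk⟩ := h
  refine ⟨g ∘ₗ e.toLinearMap, hg.comp e.surjective, ?_⟩
  rw [LinearMap.ker_comp, hk]
  apply le_antisymm
  · intro q hq
    have := radSub_le_comap e.symm.toLinearMap hq
    simpa using this
  · exact radSub_le_comap _

theorem DV_add {P Q : Type u} [AddCommGroup P] [Module R P] [AddCommGroup Q] [Module R Q]
    {x y x' y' : ℕ} (h : DV R D₁ D₂ P x y) (h' : DV R D₁ D₂ Q x' y') :
    DV R D₁ D₂ (P × Q) (x + x') (y + y') := by
  obtain ⟨g, hg, hk⟩ := h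
  obtain ⟨g', hg', hk'⟩ := h'
  let e₁ : ((Fin x → D₁) × (Fin x' → D₁)) ≃ₗ[R] (Fin (x + x') → D₁) :=
    (LinearEquiv.sumArrowLequivProdArrow (Fin x) (Fin x') R D₁).symm.trans
      (LinearEquiv.funCongrLeft R D₁ finSumFinEquiv.symm)
  let e₂ : ((Fin y → D₂) × (Fin y' → D₂)) ≃ₗ[R] (Fin (y + y') → D₂) :=
    (LinearEquiv.sumArrowLequivProdArrow (Fin y) (Fin y') R D₂).symm.trans
      (LinearEquiv.funCongrLeft R D₂ finSumFinEquiv.symm)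
  let e := (LinearEquiv.prodProdProdComm R (Fin x → D₁) (Fin y → D₂) (Fin x' → D₁)
    (Fin y' → D₂)).trans (e₁.prodCongr e₂)
  refine ⟨e.toLinearMap ∘ₗ g.prodMap g', ?_, ?_⟩
  · exact e.surjective.comp (hg.prodMap hg')
  · rw [LinearEquiv.ker_comp, LinearMap.ker_prodMap, hk, hk']
    apply le_antisymm
    · rintro ⟨p, q⟩ ⟨hp, hq⟩
      have h1 : ((p, 0) : P × Q) ∈ radSub R (P × Q) := radSub_le_comap (LinearMap.inl R P Q) hp
      have h2 : ((0, q) : P × Q) ∈ radSub R (P × Q) := radSub_le_comap (LinearMap.inr R P Q) hq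
      simpa using add_mem h1 h2
    · intro z hz
      exact ⟨radSub_le_comap (LinearMap.fst R P Q) hz, radSub_le_comap (LinearMap.snd R P Q) hz⟩

theorem DV_free (φ : R →+* D₁ × D₂) (hsurj : Function.Surjective φ)
    (hker : RingHom.ker φ = Ideal.jacobson (⊥ : Ideal R))
    (h₁ : ∀ (r : R) (d : D₁), r • d = (φ r).1 * d)
    (h₂ : ∀ (r : R) (d : D₂), r • d = (φ r).2 * d) (k : ℕ) :
    DV R D₁ D₂ (Fin k → R) k k := by
  let g : (Fin k → R) →ₗ[R] (Fin k → D₁) × (Fin k → D₂) :=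
    { toFun := fun v => (fun i => (φ (v i)).1, fun i => (φ (v i)).2)
      map_add' := by intro v w; ext <;> simp
      map_smul' := by intro r v; ext <;> simp [h₁, h₂] }
  refine ⟨g, ?_, ?_⟩
  · rintro ⟨a, b⟩
    choose v hv using fun i => hsurj (a i, b i)
    refine ⟨v, ?_⟩
    ext i <;> simp [g, hv]
  · apply le_antisymm
    · intro v hv
      have hv' : g v = 0 := hv
      have key : ∀ i, v i ∈ Ideal.jacobson (⊥ : Ideal R) := by
        intro i
        rw [← hker, RingHom.mem_ker]
        exact Prod.ext (congrFun (congrArg Prod.fst hv') i) (congrFun (congrArg Prod.snd hv') i)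
      rw [pi_eq_sum_univ' v]
      refine Submodule.sum_mem _ fun i _ => ?_
      exact radSub_smul_mem (key i) _
    · refine Submodule.span_le.2 ?_
      rintro _ ⟨a, ha, m, rfl⟩
      rw [← hker, RingHom.mem_ker] at ha
      show g (a • m) = 0
      rw [map_smul]
      ext i <;> simp [h₁, h₂, ha]

theorem le_of_inj (φ : R →+* D₁ × D₂) (hsurj : Function.Surjective φ)
    (h₁ : ∀ (r : R) (d : D₁), r • d = (φ r).1 * d)
    (h₂ : ∀ (r : R) (d : D₂), r • d = (φ r).2 * d) {x y x' y' : ℕ}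
    (f : ((Fin x → D₁) × (Fin y → D₂)) →ₗ[R] ((Fin x' → D₁) × (Fin y' → D₂)))
    (hf : Function.Injective f) : x ≤ x' ∧ y ≤ y' := by
  constructor
  · obtain ⟨e, he⟩ := hsurj (0, 1)
    have hz : ∀ a, (f (a, 0)).2 = 0 := by
      intro a
      have h0 : e • ((a, 0) : (Fin x → D₁) × (Fin y → D₂)) = 0 := by
        ext i <;> simp [h₁, h₂, he]
      have := congrArg Prod.snd (congrArg f h0)
      rw [map_smul] at this
      ext i
      simpa [h₂, he] using congrFun this i
    let g : (Fin x → D₁) →ₗ[D₁] (Fin x' → D₁) :=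
      { toFun := fun a => (f (a, 0)).1
        map_add' := by
          intro a b
          rw [← Prod.fst_add, ← map_add]; simp
        map_smul' := by
          intro d a
          obtain ⟨r, hr⟩ := hsurj (d, 0)
          have h0 : ((d • a, 0) : (Fin x → D₁) × (Fin y → D₂)) = r • (a, 0) := by
            ext i <;> simp [h₁, h₂, hr]
          rw [h0, map_smul]
          ext i; simp [h₁, hr] }
    refine le_of_fin_injective D₁ g ?_
    intro a b hab
    have : f (a, 0) = f (b, 0) := Prod.ext hab (by rw [hz, hz])
    exact congrArg Prod.fst (hf this)
  · obtain ⟨e, he⟩ := hsurj (1, 0)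
    have hz : ∀ a, (f (0, a)).1 = 0 := by
      intro a
      have h0 : e • ((0, a) : (Fin x → D₁) × (Fin y → D₂)) = 0 := by
        ext i <;> simp [h₁, h₂, he]
      have := congrArg Prod.fst (congrArg f h0)
      rw [map_smul] at this
      ext i
      simpa [h₁, he] using congrFun this i
    let g : (Fin y → D₂) →ₗ[D₂] (Fin y' → D₂) :=
      { toFun := fun a => (f (0, a)).2
        map_add' := by
          intro a b
          rw [← Prod.snd_add, ← map_add]; simp
        map_smul' := by
          intro d a
          obtain ⟨r, hr⟩ := hsurj (0, d)
          have h0 : ((0, d • a) : (Fin x → D₁) × (Fin y → D₂)) = r • (0, a) := by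
            ext i <;> simp [h₁, h₂, hr]
          rw [h0, map_smul]
          ext i; simp [h₂, hr] }
    refine le_of_fin_injective D₂ g ?_
    intro a b hab
    have : f (0, a) = f (0, b) := Prod.ext (by rw [hz, hz]) hab
    exact congrArg Prod.snd (hf this)

theorem DV_unique (φ : R →+* D₁ × D₂) (hsurj : Function.Surjective φ)
    (h₁ : ∀ (r : R) (d : D₁), r • d = (φ r).1 * d)
    (h₂ : ∀ (r : R) (d : D₂), r • d = (φ r).2 * d) {x y x' y' : ℕ}
    {P : Type u} [AddCommGroup P] [Module R P] (h : DV R D₁ D₂ P x y)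
    (h' : DV R D₁ D₂ P x' y') : x = x' ∧ y = y' := by
  obtain ⟨e⟩ := (DV_iff P x y).1 h
  obtain ⟨e'⟩ := (DV_iff P x' y').1 h'
  have a := le_of_inj φ hsurj h₁ h₂ (e.symm.trans e').toLinearMap (e.symm.trans e').injective
  have b := le_of_inj φ hsurj h₁ h₂ (e'.symm.trans e).toLinearMap (e'.symm.trans e).injective
  omega

/-- One division ring: the kernel of a map out of `D^k` is the kernel of a surjection
onto some `D^x`. -/
theorem ker_model {D : Type u} [DivisionRing D] [Module R D] (ψ : R → D)
    (hψ : Function.Surjective ψ) (h : ∀ (r : R) (d : D), r • d = ψ r * d) {k : ℕ}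
    {M : Type u} [AddCommGroup M] [Module R M] (f : (Fin k → D) →ₗ[R] M) :
    ∃ (x : ℕ) (g : (Fin k → D) →ₗ[R] (Fin x → D)), Function.Surjective g ∧
      LinearMap.ker g = LinearMap.ker f := by
  let K : Submodule D (Fin k → D) :=
    { carrier := {v | f v = 0}
      add_mem' := by
        intro a b ha hb
        simp only [Set.mem_ofPred_eq] at *
        rw [map_add, ha, hb, add_zero]
      zero_mem' := by simp
      smul_mem' := by
        intro d a ha
        simp only [Set.mem_ofPred_eq] at *
        obtain ⟨r, rfl⟩ := hψ d
        have : ψ r • a = r • a := by ext i; simp [h]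
        rw [this, map_smul, ha, smul_zero] }
  let e : ((Fin k → D) ⧸ K) ≃ₗ[D] (Fin (Module.finrank D ((Fin k → D) ⧸ K)) → D) :=
    (Module.finBasis D ((Fin k → D) ⧸ K)).equivFun
  let g₀ := e.toLinearMap ∘ₗ K.mkQ
  refine ⟨_, { toFun := g₀, map_add' := map_add g₀, map_smul' := ?_ }, ?_, ?_⟩
  · intro r a
    have : r • a = ψ r • a := by ext i; simp [h]
    rw [this, map_smul]
    ext i; simp [h]
  · exact e.surjective.comp K.mkQ_surjective
  · ext v
    have : g₀ v = 0 ↔ v ∈ K := by simp [g₀]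
    exact this

theorem DV_exists (φ : R →+* D₁ × D₂) (hsurj : Function.Surjective φ)
    (hker : RingHom.ker φ = Ideal.jacobson (⊥ : Ideal R))
    (h₁ : ∀ (r : R) (d : D₁), r • d = (φ r).1 * d)
    (h₂ : ∀ (r : R) (d : D₂), r • d = (φ r).2 * d)
    (P : Type u) [AddCommGroup P] [Module R P] [Module.Finite R P] :
    ∃ x y, DV R D₁ D₂ P x y := by
  obtain ⟨k, s, hs⟩ := Module.Finite.exists_fin' R P
  obtain ⟨e⟩ := (DV_iff _ _ _).1 (DV_free φ hsurj hker h₁ h₂ k)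
  let F : ((Fin k → D₁) × (Fin k → D₂)) →ₗ[R] (P ⧸ radSub R P) :=
    (Submodule.mapQ _ _ s (radSub_le_comap s)) ∘ₗ e.symm.toLinearMap
  have hF : Function.Surjective F := by
    intro z
    obtain ⟨p, rfl⟩ := Submodule.mkQ_surjective _ z
    obtain ⟨v, rfl⟩ := hs p
    exact ⟨e (Submodule.mkQ _ v), by simp [F]⟩
  obtain ⟨x, g₁, hg₁, hk₁⟩ := ker_model (fun r => (φ r).1)
    (Prod.fst_surjective.comp hsurj) h₁ (F ∘ₗ LinearMap.inl R _ _)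
  obtain ⟨y, g₂, hg₂, hk₂⟩ := ker_model (fun r => (φ r).2)
    (Prod.snd_surjective.comp hsurj) h₂ (F ∘ₗ LinearMap.inr R _ _)
  refine ⟨x, y, (DV_iff _ _ _).2 ⟨?_⟩⟩
  have hk : LinearMap.ker F = LinearMap.ker (g₁.prodMap g₂) := by
    rw [LinearMap.ker_prodMap, hk₁, hk₂]
    ext ⟨a, b⟩
    simp only [LinearMap.mem_ker, Submodule.mem_prod, LinearMap.comp_apply, LinearMap.inl_apply,
      LinearMap.inr_apply]
    constructor
    · intro h
      obtain ⟨r, hr⟩ := hsurj (1, 0)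
      obtain ⟨t, ht⟩ := hsurj (0, 1)
      have e1 : ((a, 0) : (Fin k → D₁) × (Fin k → D₂)) = r • (a, b) := by
        ext i <;> simp [h₁, h₂, hr]
      have e2 : ((0, b) : (Fin k → D₁) × (Fin k → D₂)) = t • (a, b) := by
        ext i <;> simp [h₁, h₂, ht]
      rw [e1, e2, map_smul, map_smul, h]
      simp
    · rintro ⟨ha, hb⟩
      have : ((a, b) : (Fin k → D₁) × (Fin k → D₂)) = (a, 0) + (0, b) := by simp
      rw [this, map_add, ha, hb, add_zero]
  exact ((F.quotKerEquivOfSurjective hF).symm.trans (Submodule.quotEquivOfEq _ _ hk)).trans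
    ((g₁.prodMap g₂).quotKerEquivOfSurjective (hg₁.prodMap hg₂))

theorem DV_sub (φ : R →+* D₁ × D₂) (hsurj : Function.Surjective φ)
    (hker : RingHom.ker φ = Ideal.jacobson (⊥ : Ideal R))
    (h₁ : ∀ (r : R) (d : D₁), r • d = (φ r).1 * d)
    (h₂ : ∀ (r : R) (d : D₂), r • d = (φ r).2 * d)
    {P Q : Type u} [AddCommGroup P] [Module R P] [AddCommGroup Q] [Module R Q]
    [Module.Finite R P] [Module.Projective R P] [Module.Finite R Q] [Module.Projective R Q]
    {x y x' y' : ℕ} (hP : DV R D₁ D₂ P x y) (hQ : DV R D₁ D₂ Q (x + x') (y + y')) :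
    ∃ (K : Type u) (_ : AddCommGroup K) (_ : Module R K), Module.Finite R K ∧
      Module.Projective R K ∧ DV R D₁ D₂ K x' y' ∧ Nonempty (Q ≃ₗ[R] P × K) := by
  have hP' := hP
  have hQ' := hQ
  obtain ⟨gP, sP, kP⟩ := hP'
  obtain ⟨gQ, sQ, kQ⟩ := hQ'
  let c₁ := LinearMap.funLeft R D₁ (Fin.castAdd x' : Fin x → Fin (x + x'))
  let c₂ := LinearMap.funLeft R D₂ (Fin.castAdd y' : Fin y → Fin (y + y'))
  have hc₁ : Function.Surjective c₁ :=
    LinearMap.funLeft_surjective_of_injective _ _ _ (Fin.castAdd_injective _ _)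
  have hc₂ : Function.Surjective c₂ :=
    LinearMap.funLeft_surjective_of_injective _ _ _ (Fin.castAdd_injective _ _)
  let s := (c₁.prodMap c₂) ∘ₗ gQ
  have hs : Function.Surjective s := (hc₁.prodMap hc₂).comp sQ
  obtain ⟨h, hh⟩ := Module.projective_lifting_property gP s sP
  have hsurjh : Function.Surjective h := by
    rw [← LinearMap.range_eq_top]
    apply radSub_nak_sup
    intro p
    obtain ⟨q, hq⟩ := hs (gP p)
    refine ⟨h q, ⟨q, rfl⟩, ?_⟩
    rw [← kP, LinearMap.mem_ker, map_sub, ← hq, ← hh]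
    simp
  obtain ⟨i, hi⟩ := Module.projective_lifting_property h LinearMap.id hsurjh
  have hi' : ∀ p, h (i p) = p := fun p => LinearMap.congr_fun hi p
  let ρ : Q →ₗ[R] LinearMap.ker h :=
    (LinearMap.id - i ∘ₗ h).codRestrict _ (by intro q; simp [hi'])
  have hρ : ρ ∘ₗ (LinearMap.ker h).subtype = LinearMap.id := by
    ext ⟨k, hk⟩
    have hk' : h k = 0 := hk
    simp [ρ, hk']
  have hfin : Module.Finite R (LinearMap.ker h) :=
    Module.Finite.of_surjective ρ (fun k => ⟨k, LinearMap.congr_fun hρ k⟩)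
  have hproj : Module.Projective R (LinearMap.ker h) := Module.Projective.of_split _ _ hρ
  let e : Q ≃ₗ[R] P × LinearMap.ker h := LinearEquiv.ofLinearMap (h.prod ρ)
    (i.coprod (LinearMap.ker h).subtype)
    (by
      apply LinearMap.ext
      rintro ⟨p, k, hk⟩
      have hk' : h k = 0 := hk
      ext <;> simp [ρ, hi', hk'])
    (by ext q; simp [ρ])
  refine ⟨LinearMap.ker h, inferInstance, inferInstance, hfin, hproj, ?_, ⟨e⟩⟩
  obtain ⟨a, b, hab⟩ := DV_exists φ hsurj hker h₁ h₂ (LinearMap.ker h)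
  have h3 := DV_unique φ hsurj h₁ h₂ (DV_equiv e (DV_add hP hab)) hQ
  have ha : a = x' := by omega
  have hb : b = y' := by omega
  rwa [← ha, ← hb]

theorem DV_diag_free (φ : R →+* D₁ × D₂) (hsurj : Function.Surjective φ)
    (hker : RingHom.ker φ = Ideal.jacobson (⊥ : Ideal R))
    (h₁ : ∀ (r : R) (d : D₁), r • d = (φ r).1 * d)
    (h₂ : ∀ (r : R) (d : D₂), r • d = (φ r).2 * d)
    {P : Type u} [AddCommGroup P] [Module R P]
    [Module.Finite R P] [Module.Projective R P] 
    {x : ℕ} (hP : DV R D₁ D₂ P x x) : Module.Free R P := by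
  obtain ⟨K, _, _, hf, _, ⟨g, hg, hk⟩, ⟨e⟩⟩ :=
    DV_sub (x' := 0) (y' := 0) φ hsurj hker h₁ h₂ hP (DV_free φ hsurj hker h₁ h₂ x)
  have : Subsingleton K := by
    apply radSub_nak (R := R)
    rw [← hk, eq_top_iff]
    intro z _
    exact Subsingleton.elim _ _
  have : Unique K := uniqueOfSubsingleton 0
  exact Module.Free.of_equiv (e.trans (LinearEquiv.prodUnique))

/-- Monoid-theoretic part. -/
theorem full_monoid (A : ℕ → ℕ → Prop) (h11 : A 1 1)
    (hadd : ∀ x y x' y', A x y → A x' y' → A (x + x') (y + y'))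
    (hsub : ∀ x y x' y', A x y → A (x + x') (y + y') → A x' y')
    (hne : ∃ x y, A x y ∧ x ≠ y) :
    ∃ n : ℕ, 0 < n ∧ (∀ x y, A x y ↔ ∃ a b c : ℕ, x = a + b * n ∧ y = a + c * n) := by
  classical
  have h00 : A 0 0 := hsub 1 1 0 0 h11 h11
  have hmul : ∀ k x y, A x y → A (k * x) (k * y) := by
    intro k x y h
    induction k with
    | zero => simpa using h00
    | succ k ih => rw [Nat.succ_mul, Nat.succ_mul]; exact hadd _ _ _ _ ih h
  have hd : ∀ k, A k k := fun k => by simpa using hmul k 1 1 h11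
  have hl : ∀ d, A d 0 → A 0 d := fun d h => hsub d 0 0 d h (by simpa using hd d)
  have hr : ∀ d, A 0 d → A d 0 := fun d h => hsub 0 d d 0 h (by simpa using hd d)
  have hdx : ∀ y d, A (y + d) y → A d 0 := fun y d h => hsub y y d 0 (hd y) (by simpa using h)
  have hdy : ∀ y d, A y (y + d) → A d 0 :=
    fun y d h => hr d (hsub y y 0 d (hd y) (by simpa using h))
  have hex : ∃ n, 0 < n ∧ A n 0 := by
    obtain ⟨x, y, h, hxy⟩ := hne
    rcases lt_or_gt_of_ne hxy with h' | h'
    · obtain ⟨d, rfl⟩ := Nat.exists_eq_add_of_lt h'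
      exact ⟨d + 1, by omega, hdy x (d + 1) h⟩
    · obtain ⟨d, rfl⟩ := Nat.exists_eq_add_of_lt h'
      exact ⟨d + 1, by omega, hdx y (d + 1) h⟩
  obtain ⟨hn, hAn⟩ := Nat.find_spec hex
  have hmin := fun m => Nat.find_min (m := m) hex
  generalize Nat.find hex = n at hn hAn hmin
  have hdiv : ∀ d, A d 0 → ∃ b, d = b * n := by
    intro d h
    have h1 : A (d % n) 0 := by
      refine hsub (d / n * n) 0 _ 0 (by simpa using hmul (d / n) n 0 hAn) ?_
      rw [mul_comm, Nat.div_add_mod]; exact h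
    have h2 : d % n = 0 := by
      by_contra h3
      exact hmin _ (Nat.mod_lt _ hn) ⟨Nat.pos_of_ne_zero h3, h1⟩
    exact ⟨d / n, (Nat.div_mul_cancel (Nat.dvd_of_mod_eq_zero h2)).symm⟩
  refine ⟨n, hn, fun x y => ⟨fun h => ?_, ?_⟩⟩
  · rcases le_total x y with h' | h'
    · obtain ⟨d, rfl⟩ := Nat.exists_eq_add_of_le h'
      obtain ⟨b, rfl⟩ := hdiv d (hdy _ _ h)
      exact ⟨x, 0, b, by simp, rfl⟩
    · obtain ⟨d, rfl⟩ := Nat.exists_eq_add_of_le h'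
      obtain ⟨b, rfl⟩ := hdiv d (hdx _ _ h)
      exact ⟨y, b, 0, rfl, by simp⟩
  · rintro ⟨a, b, c, rfl, rfl⟩
    have := hadd _ _ _ _ (hadd _ _ _ _ (hd a) (hmul b n 0 hAn)) (hmul c 0 n (hl n hAn))
    simpa using this

theorem arith_part (n : ℕ) (hn : 0 < n) (x y : ℕ) :
    (∃ a b c : ℕ, x = a + b * n ∧ y = a + c * n) ↔ n ∣ x + (n - 1) * y := by
  obtain ⟨m, rfl⟩ : ∃ m, n = m + 1 := ⟨n - 1, by omega⟩
  simp only [Nat.add_sub_cancel]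
  constructor
  · rintro ⟨a, b, c, rfl, rfl⟩
    exact ⟨a + b + m * c, by ring⟩
  · intro h
    rcases le_total x y with h' | h'
    · obtain ⟨d, rfl⟩ := Nat.exists_eq_add_of_le h'
      have h1 : (m + 1) ∣ d := by
        have h2 : x + m * (x + d) + d = (m + 1) * (x + d) := by ring
        exact (Nat.dvd_add_right h).1 (h2 ▸ dvd_mul_right _ _)
      obtain ⟨c, rfl⟩ := h1
      exact ⟨x, 0, c, by simp, by ring⟩
    · obtain ⟨d, rfl⟩ := Nat.exists_eq_add_of_le h'
      have h1 : (m + 1) ∣ d := by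
        have h2 : y + d + m * y = (m + 1) * y + d := by ring
        rw [h2] at h
        exact (Nat.dvd_add_right (dvd_mul_right _ _)).1 h
      obtain ⟨c, rfl⟩ := h1
      exact ⟨y, c, 0, by ring, by simp⟩

end helpers

/-- Let `R` be semilocal with `R/J(R) ≅ D₁ × D₂` via `φ`. If `R` has a nonfree finitely
generated projective module, then there is `n ∈ ℕ` such that `dim_φ V(R)` is the
submonoid of `ℕ₀²` generated by `(1,1)`, `(n,0)`, `(0,n)`; equivalently the set of
`(x,y)` with `n ∣ x + (n−1)y`. -/
theorem stmt16 {R D₁ D₂ : Type u} [Ring R] [DivisionRing D₁] [DivisionRing D₂]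
    (φ : R →+* D₁ × D₂) (hsurj : Function.Surjective φ)
    (hker : RingHom.ker φ = Ideal.jacobson (⊥ : Ideal R))
    (hnonfree : ∃ (P : Type u) (_ : AddCommGroup P) (_ : Module R P),
      Module.Finite R P ∧ Module.Projective R P ∧ ¬ Module.Free R P) :
    ∃ n : ℕ, 0 < n ∧
      (∀ x y : ℕ,
        (∃ (P : Type u) (_ : AddCommGroup P) (_ : Module R P),
          Module.Finite R P ∧ Module.Projective R P ∧ HasDimVector φ P x y) ↔
        (∃ a b c : ℕ, x = a + b * n ∧ y = a + c * n)) ∧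
      (∀ x y : ℕ, (∃ a b c : ℕ, x = a + b * n ∧ y = a + c * n) ↔
        n ∣ x + (n - 1) * y) := by
  letI m₁ : Module R D₁ := Module.compHom D₁ ((RingHom.fst D₁ D₂).comp φ)
  letI m₂ : Module R D₂ := Module.compHom D₂ ((RingHom.snd D₁ D₂).comp φ)
  have h₁ : ∀ (r : R) (d : D₁), r • d = (φ r).1 * d := fun _ _ => rfl
  have h₂ : ∀ (r : R) (d : D₂), r • d = (φ r).2 * d := fun _ _ => rfl
  have hDV : ∀ (P : Type u) [AddCommGroup P] [Module R P] (x y : ℕ),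
      HasDimVector φ P x y ↔ DV R D₁ D₂ P x y := fun P _ _ x y => (DV_iff P x y).symm
  simp only [hDV]
  obtain ⟨n, hn, hA⟩ := full_monoid
    (fun x y => ∃ (P : Type u) (_ : AddCommGroup P) (_ : Module R P),
      Module.Finite R P ∧ Module.Projective R P ∧ DV R D₁ D₂ P x y)
    ⟨Fin 1 → R, inferInstance, inferInstance, inferInstance, inferInstance,
      DV_free φ hsurj hker h₁ h₂ 1⟩
    (by
      rintro x y x' y' ⟨P, _, _, _, _, hP⟩ ⟨Q, _, _, _, _, hQ⟩
      exact ⟨P × Q, inferInstance, inferInstance, inferInstance, inferInstance, DV_add hP hQ⟩)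
    (by
      rintro x y x' y' ⟨P, _, _, _, _, hP⟩ ⟨Q, _, _, _, _, hQ⟩
      obtain ⟨K, i1, i2, i3, i4, hK, -⟩ := DV_sub φ hsurj hker h₁ h₂ hP hQ
      exact ⟨K, i1, i2, i3, i4, hK⟩)
    (by
      obtain ⟨P, i1, i2, i3, i4, hP⟩ := hnonfree
      obtain ⟨x, y, h⟩ := DV_exists φ hsurj hker h₁ h₂ P
      refine ⟨x, y, ⟨P, i1, i2, i3, i4, h⟩, ?_⟩
      rintro rfl
      exact hP (DV_diag_free φ hsurj hker h₁ h₂ h))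
  exact ⟨n, hn, hA, arith_part n hn⟩
end
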